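/- arXiv:2210.04595 — 3 statements merged into one kernel-verified Lean document; each statement's English description precedes it below -/
import Mathlib

section
/- Let d ≥ 1, h > 0, and let x_1,…,x_N ∈ ℝ^d be data points. Fix x ∈ ℝ^d such that |x_k − x_{i,k}| ≠ h for every i = 1,…,N and every coordinate k (so x is not on the boundary of any sample's kernel support). Let S = { i : |x_k − x_{i,k}| < h for all k }, let N_x = |S|, and (when N_x > 0) let μ ∈ ℝ^d be the arithmetic mean of the points {x_i : i ∈ S}. Then the kernel density estimator p̂(y) = (1/(N·h^d))·Σ_{i=1}^N K_d((y − x_i)/h) is differentiable at x with gradient ∇p̂(x) = (N_x/(N·h^d))·(3/(d·2^d·h²))·(μ − x) (interpreted as the zero vector when N_x = 0). -/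
open Classical

/-- The additive kernel `K_d` on `ℝ^d`: equal to
`(3/(d·2^(d+1))) · Σ_k (1 − u_k²)` on the open cube `(-1,1)^d` and `0` outside. -/
noncomputable def addKernel (d : ℕ) (u : EuclideanSpace ℝ (Fin d)) : ℝ :=
  if ∀ k, |u k| < 1 then
    (3 / ((d : ℝ) * 2 ^ (d + 1))) * ∑ k, (1 - u k ^ 2)
  else 0

theorem addKernel_eventuallyEq_of_forall_abs_lt {d : ℕ} {u : EuclideanSpace ℝ (Fin d)}
    (hu : ∀ k, |u k| < 1) :
    addKernel d =ᶠ[nhds u] fun v => (3 / ((d : ℝ) * 2 ^ (d + 1))) * (d - ‖v‖ ^ 2) := by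
  have hev : ∀ᶠ v : EuclideanSpace ℝ (Fin d) in nhds u, ∀ k, |v k| < 1 :=
    Filter.eventually_all.2 fun k =>
      (show Continuous fun v : EuclideanSpace ℝ (Fin d) => |v k| by fun_prop).continuousAt
        |>.eventually_lt continuousAt_const (hu k)
  filter_upwards [hev] with v hv
  simp [addKernel, hv, EuclideanSpace.norm_sq_eq]

theorem addKernel_eventuallyEq_zero {d : ℕ} {u : EuclideanSpace ℝ (Fin d)} {k : Fin d}
    (hu : 1 < |u k|) : addKernel d =ᶠ[nhds u] fun _ => 0 := by
  have hev : ∀ᶠ v : EuclideanSpace ℝ (Fin d) in nhds u, 1 < |v k| :=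
    continuousAt_const.eventually_lt
      (show Continuous fun v : EuclideanSpace ℝ (Fin d) => |v k| by fun_prop).continuousAt hu
  filter_upwards [hev] with v hv
  exact if_neg fun hlt => (hlt k).not_gt hv

theorem hasFDerivAt_addKernel {d : ℕ} {u : EuclideanSpace ℝ (Fin d)} (hu : ∀ k, |u k| ≠ 1) :
    HasFDerivAt (addKernel d)
      (if ∀ k, |u k| < 1 then -(3 / ((d : ℝ) * 2 ^ d)) • innerSL ℝ u else 0) u := by
  split_ifs with hlt
  · refine HasFDerivAt.congr_of_eventuallyEq ?_ (addKernel_eventuallyEq_of_forall_abs_lt hlt)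
    refine (((hasStrictFDerivAt_norm_sq u).hasFDerivAt.const_sub (d : ℝ)).const_mul
      (3 / ((d : ℝ) * 2 ^ (d + 1)))).congr_fderiv ?_
    ext v
    simp
    ring
  · push Not at hlt
    obtain ⟨k, hk⟩ := hlt
    exact (hasFDerivAt_const 0 u).congr_of_eventuallyEq
      (addKernel_eventuallyEq_zero (lt_of_le_of_ne hk (hu k).symm))

theorem hasFDerivAt_addKernel_scaled {d : ℕ} {h : ℝ} (hh : 0 < h)
    {a x : EuclideanSpace ℝ (Fin d)} (hx : ∀ k, |x k - a k| ≠ h) :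
    HasFDerivAt (fun y => addKernel d (h⁻¹ • (y - a)))
      (if ∀ k, |x k - a k| < h then
        (3 / ((d : ℝ) * 2 ^ d * h ^ 2)) • innerSL ℝ (a - x) else 0) x := by
  have habs : ∀ k, |(h⁻¹ • (x - a)) k| = |x k - a k| / h := fun k => by
    simp [abs_mul, abs_of_pos hh, div_eq_inv_mul]
  have hne : ∀ k, |(h⁻¹ • (x - a)) k| ≠ 1 := fun k => by
    rw [habs, Ne, div_eq_one_iff_eq hh.ne']
    exact hx k
  have hin : HasFDerivAt (fun y => h⁻¹ • (y - a))
      (h⁻¹ • ContinuousLinearMap.id ℝ (EuclideanSpace ℝ (Fin d))) x :=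
    ((hasFDerivAt_id x).sub_const a).const_smul h⁻¹
  refine ((hasFDerivAt_addKernel hne).comp x hin).congr_fderiv ?_
  simp only [habs, div_lt_one hh]
  split_ifs
  · ext v
    simp
    field_simp
    ring
  · simp

/-- Gradient of the kernel density estimator built from the additive kernel.
If `x` is not on the boundary of any sample's kernel support
(`|x_k − x_{i,k}| ≠ h` for all `i, k`), `S` is the set of samples whose
hyper-cube neighborhood contains `x`, `N_x = |S|`, and `μ` the arithmetic mean
of `{x_i : i ∈ S}` (with the convention `μ = 0`, hence a zero gradient factor,
when `N_x = 0`), then the KDE `p̂(y) = (1/(N·h^d)) Σᵢ K_d((y − x_i)/h)`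
is differentiable at `x` with gradient
`(N_x/(N·h^d)) • ((3/(d·2^d·h²)) • (μ − x))`. -/
theorem kde_hasGradientAt (d N : ℕ) (hd : 1 ≤ d) (h : ℝ) (hh : 0 < h)
    (X : Fin N → EuclideanSpace ℝ (Fin d)) (x : EuclideanSpace ℝ (Fin d))
    (hbd : ∀ i k, |x k - X i k| ≠ h)
    (S : Finset (Fin N)) (hS : ∀ i, i ∈ S ↔ ∀ k, |x k - X i k| < h) :
    HasGradientAt
      (fun y : EuclideanSpace ℝ (Fin d) =>
        (1 / ((N : ℝ) * h ^ d)) * ∑ i, addKernel d (h⁻¹ • (y - X i)))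
      (((S.card : ℝ) / ((N : ℝ) * h ^ d)) •
        ((3 / ((d : ℝ) * 2 ^ d * h ^ 2)) •
          (((S.card : ℝ)⁻¹ • ∑ i ∈ S, X i) - x))) x := by
  have hsum := (HasFDerivAt.fun_sum fun i (_ : i ∈ Finset.univ) =>
    hasFDerivAt_addKernel_scaled hh (hbd i)).const_mul (1 / ((N : ℝ) * h ^ d))
  rw [hasGradientAt_iff_hasFDerivAt]
  refine hsum.congr_fderiv ?_
  simp only [← hS, Finset.sum_ite_mem, Finset.univ_inter, ← Finset.smul_sum, ← map_sum,
    Finset.sum_sub_distrib, Finset.sum_const]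
  have hmean : (S.card : ℝ) • ((S.card : ℝ)⁻¹ • ∑ i ∈ S, X i - x) =
      ∑ i ∈ S, X i - S.card • x := by
    rcases S.eq_empty_or_nonempty with rfl | hne
    · simp
    · rw [smul_sub, smul_inv_smul₀ (by exact_mod_cast hne.card_pos.ne'), Nat.cast_smul_eq_nsmul]
  rw [← hmean]
  ext v
  simp
  ring
end

section
/- (Theorem 1, mean-shift property of the additive kernel.) Let d ≥ 1, h > 0 (equal bandwidth in all d dimensions, i.e. hyper-cube support), and let x_1,…,x_N ∈ ℝ^d be data points. Fix x ∈ ℝ^d such that |x_k − x_{i,k}| ≠ h for every i and every coordinate k, let S = { i : |x_k − x_{i,k}| < h for all k }, N_x = |S|, and assume N_x > 0; let μ ∈ ℝ^d be the arithmetic mean of {x_i : i ∈ S}. Let p̂ be the kernel density estimator built from K_d, let p̂_U(x) = N_x/(N·h^d) be the uniform-kernel density estimate over the cube region around x, and let c = d·2^d·h²/3. Then the gradient-ascent (mean-shift) update x⁺ = x + c·∇p̂(x)/p̂_U(x) satisfies x⁺ = μ; that is, each iteration of the mean-shift algorithm shifts the point exactly to the local mean of the samples in its hyper-cube neighborhood.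 -/
open Classical

theorem addKernel_of_forall_lt {d : ℕ} {u : EuclideanSpace ℝ (Fin d)} (hu : ∀ k, |u k| < 1) :
    addKernel d u = (3 / ((d : ℝ) * 2 ^ (d + 1))) * (d - ‖u‖ ^ 2) := by
  rw [addKernel, if_pos hu, EuclideanSpace.norm_sq_eq]
  simp

theorem abs_inv_smul_sub_lt_one_iff {d : ℕ} {h : ℝ} (hh : 0 < h)
    (y a : EuclideanSpace ℝ (Fin d)) (k : Fin d) :
    |(h⁻¹ • (y - a)) k| < 1 ↔ |y k - a k| < h := by
  rw [PiLp.smul_apply, PiLp.sub_apply, smul_eq_mul, abs_mul, abs_of_pos (inv_pos.2 hh),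
    inv_mul_lt_iff₀ hh, mul_one]

/-- Inside the open cube of half-width `h` around `a`, the rescaled additive kernel has gradient
proportional to `a - x`. -/
theorem hasGradientAt_addKernel_of_forall_lt {d : ℕ} {h : ℝ} (hh : 0 < h)
    {x a : EuclideanSpace ℝ (Fin d)} (hx : ∀ k, |x k - a k| < h) :
    HasGradientAt (fun y : EuclideanSpace ℝ (Fin d) => addKernel d (h⁻¹ • (y - a)))
      ((3 / ((d : ℝ) * 2 ^ d * h ^ 2)) • (a - x)) x := by
  have hev : ∀ᶠ y : EuclideanSpace ℝ (Fin d) in nhds x, ∀ k, |y k - a k| < h :=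
    Filter.eventually_all.2 fun k =>
      ContinuousAt.eventually_lt (by fun_prop) continuousAt_const (hx k)
  have hquad : HasFDerivAt
      (fun y : EuclideanSpace ℝ (Fin d) =>
        (3 / ((d : ℝ) * 2 ^ (d + 1))) * (d - (h⁻¹) ^ 2 * ‖y - a‖ ^ 2)) _ x :=
    ((((hasFDerivAt_id x).sub_const a).norm_sq.const_mul ((h⁻¹) ^ 2)).const_sub
      (d : ℝ)).const_mul _
  rw [hasGradientAt_iff_hasFDerivAt]
  refine (hquad.congr_of_eventuallyEq ?_).congr_fderiv ?_
  · filter_upwards [hev] with y hy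
    rw [addKernel_of_forall_lt fun k => (abs_inv_smul_sub_lt_one_iff hh y a k).2 (hy k),
      norm_smul, mul_pow, Real.norm_eq_abs, sq_abs]
  · ext v
    simp
    field_simp
    ring

/-- Outside the closed cube of half-width `h` around `a`, the rescaled additive kernel has zero
gradient. -/
theorem hasGradientAt_addKernel_of_lt {d : ℕ} {h : ℝ} (hh : 0 < h)
    {x a : EuclideanSpace ℝ (Fin d)} {k : Fin d} (hx : h < |x k - a k|) :
    HasGradientAt (fun y : EuclideanSpace ℝ (Fin d) => addKernel d (h⁻¹ • (y - a))) 0 x := by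
  have hev : ∀ᶠ y : EuclideanSpace ℝ (Fin d) in nhds x, h < |y k - a k| :=
    ContinuousAt.eventually_lt continuousAt_const (by fun_prop) hx
  refine (hasGradientAt_const x (0 : ℝ)).congr_of_eventuallyEq ?_
  filter_upwards [hev] with y hy
  exact if_neg fun hc => hy.not_gt ((abs_inv_smul_sub_lt_one_iff hh y a k).1 (hc k))

/-- **Theorem 1 (mean-shift property of the additive kernel).**
With equal bandwidth `h` in all `d` dimensions (hyper-cube support), let `p̂` be
the KDE built from `K_d`, let `x` avoid every sample's support boundary, let
`S` be the samples whose hyper-cube neighborhood contains `x` with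
`N_x = |S| > 0` and local mean `μ`, let `p̂_U(x) = N_x/(N·h^d)` and
`c = d·2^d·h²/3`. Then the mean-shift update
`x⁺ = x + c • (∇p̂(x) / p̂_U(x))` satisfies `x⁺ = μ`: each iteration shifts the
point exactly to the local mean of the samples in its hyper-cube neighborhood. -/
theorem meanShift_update_eq_local_mean (d N : ℕ) (hd : 1 ≤ d) (h : ℝ) (hh : 0 < h)
    (X : Fin N → EuclideanSpace ℝ (Fin d)) (x : EuclideanSpace ℝ (Fin d))
    (hbd : ∀ i k, |x k - X i k| ≠ h)
    (S : Finset (Fin N)) (hS : ∀ i, i ∈ S ↔ ∀ k, |x k - X i k| < h)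
    (hcard : 0 < S.card) :
    x + ((((d : ℝ) * 2 ^ d * h ^ 2 / 3) / ((S.card : ℝ) / ((N : ℝ) * h ^ d))) •
        gradient
          (fun y : EuclideanSpace ℝ (Fin d) =>
            (1 / ((N : ℝ) * h ^ d)) * ∑ i, addKernel d (h⁻¹ • (y - X i))) x)
      = (S.card : ℝ)⁻¹ • ∑ i ∈ S, X i := by
  have hgrad : ∀ i, HasGradientAt
      (fun y : EuclideanSpace ℝ (Fin d) => addKernel d (h⁻¹ • (y - X i)))
      (if i ∈ S then (3 / ((d : ℝ) * 2 ^ d * h ^ 2)) • (X i - x) else 0) x := by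
    intro i
    split_ifs with hi
    · exact hasGradientAt_addKernel_of_forall_lt hh ((hS i).1 hi)
    · obtain ⟨k, hk⟩ := not_forall.1 (mt (hS i).2 hi)
      exact hasGradientAt_addKernel_of_lt hh ((not_lt.1 hk).lt_of_ne' (hbd i k))
  have hsum : HasGradientAt
      (fun y : EuclideanSpace ℝ (Fin d) =>
        (1 / ((N : ℝ) * h ^ d)) * ∑ i, addKernel d (h⁻¹ • (y - X i)))
      ((1 / ((N : ℝ) * h ^ d)) •
        ∑ i ∈ S, (3 / ((d : ℝ) * 2 ^ d * h ^ 2)) • (X i - x)) x := by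
    rw [hasGradientAt_iff_hasFDerivAt]
    refine ((HasFDerivAt.fun_sum fun i _ => (hgrad i).hasFDerivAt).const_mul _).congr_fderiv ?_
    rw [← map_sum, Finset.sum_ite_mem, Finset.univ_inter]
    simp
  have hN0 : 0 < N := hcard.trans_le (S.card_le_univ.trans_eq (Fintype.card_fin N))
  have hN : (N : ℝ) ≠ 0 := by positivity
  have hd0 : (d : ℝ) ≠ 0 := by positivity
  have hS0 : (S.card : ℝ) ≠ 0 := by positivity
  have hc : (d : ℝ) * 2 ^ d * h ^ 2 / 3 / ((S.card : ℝ) / ((N : ℝ) * h ^ d)) *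
      (1 / ((N : ℝ) * h ^ d)) * (3 / ((d : ℝ) * 2 ^ d * h ^ 2)) = (S.card : ℝ)⁻¹ := by
    field_simp
  rw [hsum.gradient, ← Finset.smul_sum, smul_smul, smul_smul, hc, Finset.sum_sub_distrib,
    Finset.sum_const, smul_sub, ← Nat.cast_smul_eq_nsmul ℝ, inv_smul_smul₀ hS0,
    add_sub_cancel]
end

section
/- Let d ≥ 1 and fix x, x_1,…,x_N ∈ ℝ^d and h > 0 with |x_k − x_{i,k}| < h for all i and all coordinates k. Then the sum of the gradients of the shifted kernels satisfies Σ_{i=1}^N ∇_x K_d((x − x_i)/h) = (3·N/(d·2^d·h²))·(μ − x), where μ is the arithmetic mean of x_1,…,x_N; in particular, for each coordinate k, only the k-th summand of the additive kernel contributes to the k-th partial derivative, and the cross terms l ≠ k vanish. -/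
open Classical

/-- The kernel `K_d` is, up to a constant factor, `d - ‖u‖²` on the open cube `(-1,1)^d`. -/
lemma addKernel_of_abs_lt {d : ℕ} {u : EuclideanSpace ℝ (Fin d)} (hu : ∀ k, |u k| < 1) :
    addKernel d u = (3 / ((d : ℝ) * 2 ^ (d + 1))) * ((d : ℝ) - ‖u‖ ^ 2) := by
  simp [addKernel, hu, EuclideanSpace.real_norm_sq_eq, Finset.sum_sub_distrib]

/-- The gradient of a shifted and rescaled kernel inside its support. -/
lemma hasGradientAt_addKernel_smul_sub {d : ℕ} {h : ℝ} (hh : 0 < h)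
    {a x : EuclideanSpace ℝ (Fin d)} (hx : ∀ k, |x k - a k| < h) :
    HasGradientAt (fun y : EuclideanSpace ℝ (Fin d) => addKernel d (h⁻¹ • (y - a)))
      ((3 / ((d : ℝ) * 2 ^ d * h ^ 2)) • (a - x)) x := by
  have hlocal : ∀ᶠ y in nhds x, ∀ k, |y k - a k| < h :=
    Filter.eventually_all.2 fun k =>
      ContinuousAt.eventually_lt (by fun_prop) continuousAt_const (hx k)
  have heq : (fun y : EuclideanSpace ℝ (Fin d) => addKernel d (h⁻¹ • (y - a))) =ᶠ[nhds x]
      fun y => (3 / ((d : ℝ) * 2 ^ (d + 1))) * ((d : ℝ) - ‖h⁻¹ • (y - a)‖ ^ 2) := by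
    filter_upwards [hlocal] with y hy
    refine addKernel_of_abs_lt fun k => ?_
    simpa [abs_mul, abs_of_pos hh, inv_mul_lt_iff₀ hh] using hy k
  have hquad := ((((hasFDerivAt_id (𝕜 := ℝ) x).sub_const a).const_smul h⁻¹).norm_sq.const_sub
    (d : ℝ)).const_mul (3 / ((d : ℝ) * 2 ^ (d + 1)))
  rw [hasGradientAt_iff_hasFDerivAt]
  refine (hquad.congr_of_eventuallyEq heq).congr_fderiv ?_
  ext v
  simp [pow_succ]
  ring

/-- If `|x_k − x_{i,k}| < h` for all samples `i` and coordinates `k`, then the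
sum of the gradients of the shifted kernels satisfies
`Σᵢ ∇ₓ K_d((x − x_i)/h) = (3N/(d·2^d·h²)) • (μ − x)`,
where `μ` is the arithmetic mean of `x_1, …, x_N`. -/
theorem sum_gradient_shiftedKernels (d N : ℕ) (hd : 1 ≤ d) (h : ℝ) (hh : 0 < h)
    (X : Fin N → EuclideanSpace ℝ (Fin d)) (x : EuclideanSpace ℝ (Fin d))
    (hx : ∀ i k, |x k - X i k| < h) :
    ∑ i, gradient (fun y : EuclideanSpace ℝ (Fin d) => addKernel d (h⁻¹ • (y - X i))) x
      = ((3 * (N : ℝ)) / ((d : ℝ) * 2 ^ d * h ^ 2)) •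
          (((N : ℝ)⁻¹ • ∑ i, X i) - x) := by
  simp_rw [fun i => (hasGradientAt_addKernel_smul_sub hh (hx i)).gradient]
  rw [← Finset.smul_sum, Finset.sum_sub_distrib, Finset.sum_const, Finset.card_univ,
    Fintype.card_fin, ← Nat.cast_smul_eq_nsmul ℝ]
  obtain rfl | hN := eq_or_ne N 0
  · simp
  · have hN' : (N : ℝ) ≠ 0 := Nat.cast_ne_zero.2 hN
    rw [mul_div_right_comm, mul_smul, smul_sub (N : ℝ), smul_inv_smul₀ hN']
end
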